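/- Let α be a positive integer with α ≤ max G, and let κ_i^g (i = 0,…,m−1, g ∈ G) be arbitrary real numbers (no admissibility assumption). Then for all integers k, u, i with 0 ≤ k ≤ u and 0 ≤ i ≤ m−1, one has ⟨x^k·L_u^α(x), x^i⟩_ξ = Γ(α)·Σ_{g∈G} κ_i^g·Σ_{l=k}^{g} (α−l)_k·w_l^g·binom(u+l−k, l−k), where ⟨·,·⟩_ξ is the bilinear form defined below and binom(u+l−k, l−k) is the ordinary integer binomial coefficient. -/

import Mathlib

open Polynomial Finset

/-- Pochhammer symbol `(a)_l = a (a+1) ⋯ (a+l-1)`, with `(a)_0 = 1`. -/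
noncomputable def poch (a : ℝ) (l : ℕ) : ℝ := ∏ t ∈ Finset.range l, (a + t)

/-- Generalized binomial coefficient `binom (n+α, n−j) = (α+j+1)⋯(α+n)/(n−j)!`. -/
noncomputable def genBinom (α : ℝ) (n j : ℕ) : ℝ :=
  (∏ t ∈ Finset.Ico (j + 1) (n + 1), (α + t)) / (Nat.factorial (n - j) : ℝ)

/-- Laguerre polynomial `L_n^α(x) = Σ_{j=0}^n ((−x)^j/j!)·binom(n+α, n−j)`. -/
noncomputable def laguerre (α : ℝ) (n : ℕ) : Polynomial ℝ :=
  ∑ j ∈ Finset.range (n + 1),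
    Polynomial.C ((-1 : ℝ) ^ j / (Nat.factorial j : ℝ) * genBinom α n j) * Polynomial.X ^ j

/-- Laguerre polynomials indexed by `ℤ`, with the convention `L_u^α = 0` for `u < 0`. -/
noncomputable def laguerreZ (α : ℝ) (n : ℤ) : Polynomial ℝ :=
  if n < 0 then 0 else laguerre α n.toNat

/-- The polynomial `binom (x+l, l) = (x+1)(x+2)⋯(x+l)/l!`. -/
noncomputable def binomPoly (l : ℕ) : Polynomial ℝ :=
  Polynomial.C ((Nat.factorial l : ℝ)⁻¹) *
    ∏ t ∈ Finset.range l, (Polynomial.X + Polynomial.C ((t : ℝ) + 1))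

/-- The Casoratian `Ω_G(x) = det (R_{g_l}(x−j))_{l,j=1,…,m}`. -/
noncomputable def casoratian {m : ℕ} (R : Fin m → Polynomial ℝ) (x : ℝ) : ℝ :=
  Matrix.det (Matrix.of fun l j : Fin m => (R l).eval (x - ((j : ℕ) + 1)))

/-- The maximum of the finite set `G` (given by the values of `g`). -/
noncomputable def Gmax {m : ℕ} (g : Fin m → ℕ) : ℕ := Finset.univ.sup g

/-- The polynomial `q_n`, defined as an `(m+1)×(m+1)` determinant whose first row is
`(L_n^α(x), …, L_{n−m}^α(x))` and whose `(h+1)`-th row is `(R_{g_h}(n), …, R_{g_h}(n−m))`. -/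
noncomputable def qpoly (α : ℝ) {m : ℕ} (R : Fin m → Polynomial ℝ) (n : ℤ) : Polynomial ℝ :=
  Matrix.det (Matrix.of fun i j : Fin (m + 1) =>
    if h : (i : ℕ) = 0 then laguerreZ α (n - (j : ℕ))
    else Polynomial.C ((R ⟨(i : ℕ) - 1, by have := i.isLt; omega⟩).eval ((n : ℝ) - ((j : ℕ) : ℝ))))

/-- `q_n` extended by the convention `q_k = 0` for `k < 0`. -/
noncomputable def qZ (α : ℝ) {m : ℕ} (R : Fin m → Polynomial ℝ) (n : ℤ) : Polynomial ℝ :=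
  if n < 0 then 0 else qpoly α R n

/-- `momFun β p k = L_β(p(x)·x^k)`, where `L_β` is the moment functional on Laurent
polynomials determined by `L_β(x^j) = Γ(β+j+1)`. -/
noncomputable def momFun (β : ℝ) (p : Polynomial ℝ) (k : ℤ) : ℝ :=
  ∑ t ∈ Finset.range (p.natDegree + 1), p.coeff t * Real.Gamma (β + t + k + 1)

/-- The bilinear form `⟨p, q⟩ = L_{α−m}(p·q) + Σ_{i=0}^{m−1} (q^{(i)}(0)/i!)·L_α(p·U_i)`,
where `U_i(x) = Σ_{g∈G} ( −x^{i−m}/m + κ_i^g·Σ_{l=0}^g (α−l)_l w_l^g x^{−l−1} )`. -/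
noncomputable def bilin (α : ℝ) {m : ℕ} (g : Fin m → ℕ) (κ : ℕ → Fin m → ℝ)
    (w : Fin m → ℕ → ℝ) (p q : Polynomial ℝ) : ℝ :=
  momFun (α - m) (p * q) 0 +
    ∑ i ∈ Finset.range m,
      (Polynomial.eval 0 (Polynomial.derivative^[i] q) / (Nat.factorial i : ℝ)) *
        (∑ h : Fin m,
          (-(1 / (m : ℝ)) * momFun α p ((i : ℤ) - (m : ℤ)) +
            κ i h * ∑ l ∈ Finset.range (g h + 1),
              poch (α - l) l * w h l * momFun α p (-((l : ℤ) + 1))))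

/-- The bilinear form `⟨p, q⟩_ξ` (case `α` a positive integer with `α ≤ max G`). -/
noncomputable def bilinXi (α : ℕ) {m : ℕ} (g : Fin m → ℕ) (κ : ℕ → Fin m → ℝ)
    (w : Fin m → ℕ → ℝ) (p q : Polynomial ℝ) : ℝ :=
  momFun ((α - m : ℕ) : ℝ) (p * Polynomial.derivative^[m - α] q) 0 +
    ∑ i ∈ Finset.range m,
      (Polynomial.eval 0 (Polynomial.derivative^[i] q) / (Nat.factorial i : ℝ)) *
        (∑ h : Fin m,
          (poch ((i : ℝ) - m + α + 1) (m - α) * (-(1 / (m : ℝ))) * momFun α p ((i : ℤ) - (m : ℤ)) +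
            κ i h * ∑ l ∈ Finset.range (if g h < α then g h + 1 else α),
              poch ((α : ℝ) - l) l * w h l * momFun α p (-((l : ℤ) + 1)))) +
    Real.Gamma α *
      ∑ i ∈ Finset.range m,
        (Polynomial.eval 0 (Polynomial.derivative^[i] q) / (Nat.factorial i : ℝ)) *
          ∑ h ∈ Finset.univ.filter (fun h : Fin m => α ≤ g h),
            κ i h *
              ∑ j ∈ Finset.range (g h - α + 1),
                (Polynomial.eval 0 (Polynomial.derivative^[j] p) / (Nat.factorial j : ℝ)) *
                  ∑ l ∈ Finset.Icc (α + j) (g h), poch ((α : ℝ) - l) j * w h l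

lemma smeval_desc (n : ℕ) (r : ℝ) :
    (descPochhammer ℤ n).smeval r = ∏ j ∈ Finset.range n, (r - j) := by
  induction n with
  | zero => simp [Polynomial.smeval_one]
  | succ n ih =>
    rw [descPochhammer_succ_right, Polynomial.smeval_mul, ih, Finset.prod_range_succ,
      Polynomial.smeval_sub, Polynomial.smeval_X, Polynomial.smeval_natCast]
    simp

lemma poch_eq_desc (a : ℝ) (n : ℕ) :
    poch a n = ∏ j ∈ Finset.range n, (a + n - 1 - j) := by
  unfold poch
  rw [← Finset.prod_range_reflect]
  refine Finset.prod_congr rfl fun j hj => ?_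
  rw [Finset.mem_range] at hj
  rw [show n - 1 - j = n - (1 + j) by omega, Nat.cast_sub (by omega)]
  push_cast
  ring

lemma poch_neg (b : ℝ) (n : ℕ) :
    (-1) ^ n * poch b n = ∏ j ∈ Finset.range n, (-b - j) := by
  unfold poch
  rw [← Finset.card_range n, ← Finset.prod_const, Finset.card_range, ← Finset.prod_mul_distrib]
  refine Finset.prod_congr rfl fun j _ => ?_
  ring

lemma genProd (a : ℝ) (u j : ℕ) (h : j ≤ u) :
    ∏ t ∈ Finset.Ico (j + 1) (u + 1), (a + t) = ∏ i ∈ Finset.range (u - j), (a + u - i) := by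
  rw [Finset.prod_Ico_eq_prod_range, ← Finset.prod_range_reflect]
  rw [show u + 1 - (j + 1) = u - j by omega]
  refine Finset.prod_congr rfl fun i hi => ?_
  rw [Finset.mem_range] at hi
  rw [show j + 1 + (u - j - 1 - i) = u - i by omega, Nat.cast_sub (by omega)]
  ring

lemma poch_add (a : ℝ) (k j : ℕ) : poch a (k + j) = poch a k * poch (a + k) j := by
  unfold poch
  rw [Finset.prod_range_add]
  congr 1
  refine Finset.prod_congr rfl fun i _ => ?_
  push_cast
  ring

/-- Chu-Vandermonde. -/
lemma chu (a b : ℝ) (u : ℕ) :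
    ∑ j ∈ Finset.range (u + 1), (-1 : ℝ) ^ j / (Nat.factorial j : ℝ) * genBinom a u j * poch b j
      = poch (a - b + 1) u / (Nat.factorial u : ℝ) := by
  have key := Ring.descPochhammer_smeval_add (r := -b) (s := a + u) u (Commute.all _ _)
  simp only [smeval_desc] at key
  rw [Finset.Nat.sum_antidiagonal_eq_sum_range_succ_mk] at key
  rw [poch_eq_desc]
  have e : (a - b + 1 + u - 1) = -b + (a + u) := by ring
  rw [e, key, Finset.sum_div]
  refine Finset.sum_congr rfl fun j hj => ?_
  have hj' : j ≤ u := by rw [Finset.mem_range] at hj; omega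
  unfold genBinom
  rw [genProd a u j hj', ← poch_neg, Nat.cast_choose ℝ hj']
  have h1 : (Nat.factorial j : ℝ) ≠ 0 := by positivity
  have h2 : (Nat.factorial (u - j) : ℝ) ≠ 0 := by positivity
  have h3 : (Nat.factorial u : ℝ) ≠ 0 := by positivity
  field_simp

lemma poch_zero_of (n l : ℕ) (h : n < l) (a : ℝ) (ha : a = -(n : ℝ)) : poch a l = 0 := by
  unfold poch
  exact Finset.prod_eq_zero (Finset.mem_range.2 h) (by rw [ha]; ring)

lemma key_id (α : ℝ) (k u l : ℕ) (hku : k ≤ u) :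
    ∑ j ∈ Finset.range (u + 1),
      (-1 : ℝ) ^ j / (Nat.factorial j : ℝ) * genBinom α u j * poch (α - l) (k + j) =
    if k ≤ l then poch (α - l) k * (Nat.choose (u + l - k) (l - k) : ℝ) else 0 := by
  have h1 : ∑ j ∈ Finset.range (u + 1),
      (-1 : ℝ) ^ j / (Nat.factorial j : ℝ) * genBinom α u j * poch (α - l) (k + j) =
      poch (α - l) k * (poch ((l : ℝ) - k + 1) u / (Nat.factorial u : ℝ)) := by
    have := chu α (α - l + k) u
    rw [show α - (α - l + k) + 1 = (l : ℝ) - k + 1 by ring] at this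
    rw [← this, Finset.mul_sum]
    refine Finset.sum_congr rfl fun j _ => ?_
    rw [poch_add]
    ring
  rw [h1]
  split_ifs with h
  · congr 1
    obtain ⟨d, rfl⟩ := Nat.exists_eq_add_of_le h
    rw [show u + (k + d) - k = u + d by omega, show k + d - k = d by omega]
    rw [poch_eq_desc, ← descPochhammer_eval_eq_prod_range,
      show (((k + d : ℕ) : ℝ) - k + 1 + u - 1) = ((u + d : ℕ) : ℝ) by push_cast; ring,
      descPochhammer_eval_eq_descFactorial, Nat.descFactorial_eq_factorial_mul_choose]
    have h3 : (Nat.factorial u : ℝ) ≠ 0 := by positivity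
    rw [Nat.choose_symm_add]
    push_cast
    field_simp
  · rw [poch_zero_of (k - l - 1) u (by omega) _ (by
      rw [Nat.cast_sub (by omega), Nat.cast_sub (by omega)]; push_cast; ring)]
    simp

/-- linear functional sending `X^t` to `f t`. -/
noncomputable def linF (f : ℕ → ℝ) : Polynomial ℝ →ₗ[ℝ] ℝ :=
  Polynomial.lsum (fun t => f t • (LinearMap.id : ℝ →ₗ[ℝ] ℝ))

lemma linF_range (f : ℕ → ℝ) (p : Polynomial ℝ) (N : ℕ) (hN : p.natDegree < N) :
    linF f p = ∑ t ∈ Finset.range N, p.coeff t * f t := by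
  unfold linF
  rw [Polynomial.lsum_apply, Polynomial.sum_over_range' _ _ N hN]
  · refine Finset.sum_congr rfl fun j _ => ?_
    simp [mul_comm]
  · simp

lemma linF_mono (f : ℕ → ℝ) (c : ℝ) (n : ℕ) :
    linF f (Polynomial.C c * Polynomial.X ^ n) = c * f n := by
  unfold linF
  rw [Polynomial.lsum_apply, Polynomial.C_mul_X_pow_eq_monomial, Polynomial.sum_monomial_index]
  all_goals simp [mul_comm]

lemma mom_linF (β : ℝ) (p : Polynomial ℝ) (k : ℤ) :
    momFun β p k = linF (fun t => Real.Gamma (β + t + k + 1)) p := by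
  rw [linF_range _ p (p.natDegree + 1) (by omega)]
  rfl

lemma linF_mul (f : ℕ → ℝ) (c : ℝ) (n : ℕ) (p : Polynomial ℝ) :
    linF f (p * (Polynomial.C c * Polynomial.X ^ n)) = c * linF (fun t => f (t + n)) p := by
  induction p using Polynomial.induction_on' with
  | add p q hp hq => rw [add_mul, map_add, map_add, hp, hq]; ring
  | monomial t a =>
    rw [← Polynomial.C_mul_X_pow_eq_monomial, linF_mono]
    rw [show (Polynomial.C a * Polynomial.X ^ t * (Polynomial.C c * Polynomial.X ^ n) :
      Polynomial ℝ) = Polynomial.C (a * c) * Polynomial.X ^ (t + n) by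
        rw [Polynomial.C_mul, pow_add]; ring, linF_mono]
    ring

lemma linF_lag (f : ℕ → ℝ) (α : ℝ) (k u : ℕ) :
    linF f (Polynomial.X ^ k * laguerre α u) = ∑ j ∈ Finset.range (u + 1),
      (-1 : ℝ) ^ j / (Nat.factorial j : ℝ) * genBinom α u j * f (k + j) := by
  unfold laguerre
  rw [Finset.mul_sum, map_sum]
  refine Finset.sum_congr rfl fun j _ => ?_
  rw [show (Polynomial.X ^ k * (Polynomial.C ((-1 : ℝ) ^ j / (Nat.factorial j : ℝ) *
    genBinom α u j) * Polynomial.X ^ j) : Polynomial ℝ) = Polynomial.C ((-1 : ℝ) ^ j /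
    (Nat.factorial j : ℝ) * genBinom α u j) * Polynomial.X ^ (k + j) by
      rw [pow_add]; ring, linF_mono]

lemma partA (α m i : ℕ) (hi : i < m) (p : Polynomial ℝ) :
    momFun ((α - m : ℕ) : ℝ) (p * Polynomial.derivative^[m - α] (Polynomial.X ^ i)) 0 =
      poch ((i : ℝ) - m + α + 1) (m - α) * momFun α p ((i : ℤ) - (m : ℤ)) := by
  rw [Polynomial.iterate_derivative_X_pow_eq_C_mul, mom_linF, linF_mul, mom_linF]
  rcases le_total m α with h | h
  · rw [show m - α = 0 by omega]
    simp only [Nat.descFactorial_zero, poch, Finset.range_zero, Finset.prod_empty,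
      Nat.cast_one, one_mul]
    congr 2
    funext t
    congr 1
    push_cast [Nat.cast_sub h]
    simp
    ring
  · have e : poch ((i : ℝ) - m + α + 1) (m - α) = (i.descFactorial (m - α) : ℝ) := by
      rw [poch_eq_desc, ← descPochhammer_eval_eq_prod_range,
        ← descPochhammer_eval_eq_descFactorial]
      congr 1
      rw [Nat.cast_sub h]
      ring
    rw [e]
    by_cases h2 : i < m - α
    · rw [Nat.descFactorial_of_lt h2]; simp
    · congr 2
      congr 1
      funext t
      congr 1
      rw [show α - m = 0 by omega]
      push_cast [Nat.cast_sub h, Nat.cast_sub (show m - α ≤ i by omega)]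
      ring

lemma Gamma_poch (x : ℝ) (hx : 0 < x) (n : ℕ) :
    Real.Gamma (x + n) = poch x n * Real.Gamma x := by
  induction n with
  | zero => simp [poch]
  | succ n ih =>
    rw [show x + (n + 1 : ℕ) = (x + n) + 1 by push_cast; ring,
      Real.Gamma_add_one (by positivity), ih]
    unfold poch
    rw [Finset.prod_range_succ]
    ring

lemma eval_der (p : Polynomial ℝ) (j : ℕ) :
    Polynomial.eval 0 (Polynomial.derivative^[j] p) / (Nat.factorial j : ℝ) = p.coeff j := by
  rw [← Polynomial.coeff_zero_eq_eval_zero, Polynomial.coeff_iterate_derivative]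
  have h3 : (Nat.factorial j : ℝ) ≠ 0 := by positivity
  simp only [zero_add, Nat.descFactorial_self, nsmul_eq_mul]
  field_simp

lemma partB (α l : ℕ) (hl : l < α) (p : Polynomial ℝ) :
    poch ((α : ℝ) - l) l * momFun α p (-((l : ℤ) + 1)) =
      Real.Gamma α * linF (fun t => poch ((α : ℝ) - l) t) p := by
  have hx : (0 : ℝ) < (α : ℝ) - l := by
    have : (l : ℝ) < α := by exact_mod_cast hl
    linarith
  rw [mom_linF, linF_range _ p _ (Nat.lt_succ_self _), linF_range _ p _ (Nat.lt_succ_self _),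
    Finset.mul_sum, Finset.mul_sum]
  refine Finset.sum_congr rfl fun t _ => ?_
  have h1 := Gamma_poch _ hx l
  have h2 := Gamma_poch _ hx t
  rw [sub_add_cancel] at h1
  rw [show (α : ℝ) + t + ((-((l : ℤ) + 1) : ℤ) : ℝ) + 1 = (α : ℝ) - l + t by push_cast; ring,
    h2, h1]
  ring

lemma partC (α l : ℕ) (hl : α ≤ l) (p : Polynomial ℝ) :
    ∑ j ∈ Finset.range (l - α + 1), p.coeff j * poch ((α : ℝ) - l) j =
      linF (fun t => poch ((α : ℝ) - l) t) p := by
  rw [linF_range _ p (p.natDegree + 1 + (l - α + 1)) (by omega)]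
  refine Finset.sum_subset (Finset.range_mono (by omega)) fun j _ hj => ?_
  rw [Finset.mem_range] at hj
  rw [poch_zero_of (l - α) j (by omega) _ (by rw [Nat.cast_sub hl]; ring), mul_zero]

lemma partD (α G : ℕ) (hG : α ≤ G) (w : ℕ → ℝ) (p : Polynomial ℝ) :
    ∑ j ∈ Finset.range (G - α + 1),
      (Polynomial.eval 0 (Polynomial.derivative^[j] p) / (Nat.factorial j : ℝ)) *
        ∑ l ∈ Finset.Icc (α + j) G, poch ((α : ℝ) - l) j * w l =
    ∑ l ∈ Finset.Ico α (G + 1), w l * linF (fun t => poch ((α : ℝ) - l) t) p := by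
  simp only [eval_der, Finset.mul_sum]
  rw [Finset.sum_comm' (s' := fun l => Finset.range (l - α + 1)) (t' := Finset.Ico α (G + 1))]
  · refine Finset.sum_congr rfl fun l hl => ?_
    rw [Finset.mem_Ico] at hl
    rw [← partC α l hl.1, Finset.mul_sum]
    refine Finset.sum_congr rfl fun j _ => ?_
    ring
  · intro x y
    simp only [Finset.mem_range, Finset.mem_Icc, Finset.mem_Ico]
    omega

lemma partE (α G : ℕ) (w : ℕ → ℝ) (p : Polynomial ℝ) :
    (∑ l ∈ Finset.range (if G < α then G + 1 else α),
        poch ((α : ℝ) - l) l * w l * momFun α p (-((l : ℤ) + 1))) +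
      Real.Gamma α * (if α ≤ G then ∑ j ∈ Finset.range (G - α + 1),
      (Polynomial.eval 0 (Polynomial.derivative^[j] p) / (Nat.factorial j : ℝ)) *
        ∑ l ∈ Finset.Icc (α + j) G, poch ((α : ℝ) - l) j * w l else 0) =
    Real.Gamma α * ∑ l ∈ Finset.range (G + 1), w l * linF (fun t => poch ((α : ℝ) - l) t) p := by
  have hB : ∑ l ∈ Finset.range (if G < α then G + 1 else α),
        poch ((α : ℝ) - l) l * w l * momFun α p (-((l : ℤ) + 1)) =
      Real.Gamma α * ∑ l ∈ Finset.range (if G < α then G + 1 else α),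
        w l * linF (fun t => poch ((α : ℝ) - l) t) p := by
    rw [Finset.mul_sum]
    refine Finset.sum_congr rfl fun l hl => ?_
    have hl' : l < α := by
      rw [Finset.mem_range] at hl
      split_ifs at hl <;> omega
    have := partB α l hl' p
    linear_combination w l * this
  rw [hB]
  by_cases h : α ≤ G
  · rw [if_pos h, if_neg (by omega), partD α G h, ← mul_add,
      Finset.sum_range_add_sum_Ico _ (by omega)]
  · rw [if_neg h, if_pos (by omega)]
    ring

lemma partF (α G k u : ℕ) (hku : k ≤ u) (w : ℕ → ℝ) :
    ∑ l ∈ Finset.range (G + 1), w l *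
        linF (fun t => poch ((α : ℝ) - l) t) (Polynomial.X ^ k * laguerre (α : ℝ) u) =
      ∑ l ∈ Finset.Icc k G,
        poch ((α : ℝ) - l) k * w l * (Nat.choose (u + l - k) (l - k) : ℝ) := by
  have hs : Finset.Icc k G ⊆ Finset.range (G + 1) := by
    intro x hx
    simp only [Finset.mem_Icc, Finset.mem_range] at *
    omega
  rw [← Finset.sum_subset hs]
  · refine Finset.sum_congr rfl fun l hl => ?_
    rw [Finset.mem_Icc] at hl
    rw [linF_lag, key_id _ _ _ _ hku, if_pos hl.1]
    ring
  · intro l hl hl2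
    simp only [Finset.mem_Icc, Finset.mem_range] at *
    rw [linF_lag, key_id _ _ _ _ hku, if_neg (by omega), mul_zero]

/-- key Lemma for the case `α = 1,…,max G`: for arbitrary `κ_i^g`,
`0 ≤ k ≤ u` and `0 ≤ i ≤ m−1`,
`⟨x^k·L_u^α, x^i⟩_ξ = Γ(α)·Σ_{g∈G} κ_i^g·Σ_{l=k}^{g} (α−l)_k·w_l^g·binom(u+l−k, l−k)`. -/
theorem statement10 (α : ℕ) (hα : 0 < α) (m : ℕ) (hm : 0 < m) (g : Fin m → ℕ)
    (hg : StrictMono g) (hgpos : ∀ i, 0 < g i) (hαG : α ≤ Gmax g)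
    (R : Fin m → Polynomial ℝ)
    (hdeg : ∀ i, (R i).natDegree = g i)
    (hlead : ∀ i, (R i).leadingCoeff = 1 / (Nat.factorial (g i) : ℝ))
    (w : Fin m → ℕ → ℝ)
    (hw : ∀ h : Fin m, R h = ∑ l ∈ Finset.range (g h + 1), Polynomial.C (w h l) * binomPoly l)
    (κ : ℕ → Fin m → ℝ) :
    ∀ k u i : ℕ, k ≤ u → i < m →
      bilinXi α g κ w (Polynomial.X ^ k * laguerre (α : ℝ) u) (Polynomial.X ^ i) =
        Real.Gamma α * ∑ h : Fin m, κ i h *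
          ∑ l ∈ Finset.Icc k (g h),
            poch ((α : ℝ) - l) k * w h l * (Nat.choose (u + l - k) (l - k) : ℝ) := by
  intro k u i hku hi
  have hc : ∀ i', Polynomial.eval 0 (Polynomial.derivative^[i'] (Polynomial.X ^ i :
      Polynomial ℝ)) / (Nat.factorial i' : ℝ) = if i' = i then 1 else 0 := by
    intro i'
    rw [eval_der, Polynomial.coeff_X_pow]
  unfold bilinXi
  simp only [hc, ite_mul, one_mul, zero_mul, Finset.sum_ite_eq', Finset.mem_range, hi, if_true]
  rw [partA α m i hi, Finset.sum_add_distrib, Finset.sum_const, Finset.card_univ,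
    Fintype.card_fin, nsmul_eq_mul, Finset.sum_filter]
  have hm' : (m : ℝ) ≠ 0 := by positivity
  have hE : ∀ h : Fin m, _ := fun h =>
    partE α (g h) (w h) (Polynomial.X ^ k * laguerre (α : ℝ) u)
  simp only [partF _ _ _ _ hku] at hE
  have hfin : Real.Gamma α * ∑ h : Fin m, κ i h *
          ∑ l ∈ Finset.Icc k (g h),
            poch ((α : ℝ) - l) k * w h l * (Nat.choose (u + l - k) (l - k) : ℝ) =
      ∑ h : Fin m, κ i h * (Real.Gamma α * ∑ l ∈ Finset.Icc k (g h),
            poch ((α : ℝ) - l) k * w h l * (Nat.choose (u + l - k) (l - k) : ℝ)) := by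
    rw [Finset.mul_sum]
    refine Finset.sum_congr rfl fun h _ => ?_
    ring
  rw [hfin]
  simp only [← hE, mul_add, Finset.sum_add_distrib]
  have hlast : ∀ A B C D E : ℝ, C = E → A * B + (m * (A * -(1 / (m : ℝ)) * B) + D) + C = D + E := by
    intro A B C D E h
    rw [h]
    field_simp
    ring
  apply hlast
  rw [Finset.mul_sum]
  refine Finset.sum_congr rfl fun h _ => ?_
  split_ifs
  · ring
  · ring
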